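/- Fix k ≥ 1 and a nonnegative C² function 𝒱 : ℝ^d → ℝ with 𝒱(x) = |x|^k for |x| ≥ 1, and fix constants a_1,...,a_d > 0. Then there exist positive constants c_5, c_6 (depending on k) such that for all x ∈ ℝ^d, sup_{u ∈ M(x)} L^u 𝒱(x) ≤ c_5 - c_6 |x|^k, where L^u 𝒱(x) = (1/2) Σ_{i=1}^d a_i ∂_{ii} 𝒱(x) + Σ_{i=1}^d b_i(x,u) ∂_i 𝒱(x). -/

import Mathlib

open Finset

noncomputable section

/-- `d × d` real matrices represented as functions. -/
abbrev Mat (d : ℕ) := Fin d → Fin d → ℝ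

/-- Euclidean space `ℝ^d`. -/
abbrev E (d : ℕ) := EuclideanSpace ℝ (Fin d)

/-- positive part `a⁺ = max(a,0)`. -/
def pp (a : ℝ) : ℝ := max a 0

/-- negative part `a⁻ = max(-a,0)`. -/
def nn (a : ℝ) : ℝ := max (-a) 0

/-- The control set `M`: nonnegative matrices with zero diagonal whose
column sums (off the diagonal) are at most `1`. -/
def MM (d : ℕ) : Set (Mat d) :=
  {u | (∀ i j, 0 ≤ u i j) ∧ (∀ i, u i i = 0) ∧
    ∀ i, ∑ k ∈ univ.filter (· ≠ i), u k i ≤ 1}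

/-- The state-dependent control set `M(x)`. -/
def Mx (d : ℕ) (x : E d) : Set (Mat d) :=
  {u | u ∈ MM d ∧ ∀ i, ∑ j ∈ univ.filter (· ≠ i), u i j * nn (x j) ≤ pp (x i)}
/-- `q_i(x,u) = x_i⁺ - Σ_{j ≠ i} u_{ij} x_j⁻`. -/
def qf (d : ℕ) (x : E d) (u : Mat d) (i : Fin d) : ℝ :=
  pp (x i) - ∑ j ∈ univ.filter (· ≠ i), u i j * nn (x j)

/-- The drift
`b_i(x,u) = ℓ_i + μ_i x_i⁻ - Σ_{j ≠ i} μ_{ij} u_{ij} x_j⁻ - γ_i q_i(x,u)`. -/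
def bf (d : ℕ) (ℓ μ γ : Fin d → ℝ) (μo : Fin d → Fin d → ℝ)
    (x : E d) (u : Mat d) (i : Fin d) : ℝ :=
  ℓ i + μ i * nn (x i) - (∑ j ∈ univ.filter (· ≠ i), μo i j * u i j * nn (x j))
    - γ i * qf d x u i


theorem le_one_of_mem_MM {d : ℕ} {u : Mat d} (hu : u ∈ MM d) (i j : Fin d) : u i j ≤ 1 := by
  obtain ⟨h0, hd, hs⟩ := hu
  by_cases h : i = j
  · rw [h, hd]; exact zero_le_one
  · exact (single_le_sum (f := fun k => u k j) (fun k _ => h0 k j)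
      (by simp [h] : i ∈ univ.filter (· ≠ j))).trans (hs j)

theorem nn_nonneg (a : ℝ) : 0 ≤ nn a := le_max_right _ _

theorem pp_nonneg (a : ℝ) : 0 ≤ pp a := le_max_right _ _

theorem nn_le_abs (a : ℝ) : nn a ≤ |a| := max_le (neg_le_abs a) (abs_nonneg a)

theorem pp_le_abs (a : ℝ) : pp a ≤ |a| := max_le (le_abs_self a) (abs_nonneg a)

theorem abs_apply_le_norm {d : ℕ} (x : E d) (i : Fin d) : |x i| ≤ ‖x‖ := by
  simpa using PiLp.norm_apply_le x i

theorem inflow_nonneg {d : ℕ} (x : E d) {u : Mat d} (hu : u ∈ MM d) (i : Fin d) :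
    0 ≤ ∑ j ∈ univ.filter (· ≠ i), u i j * nn (x j) :=
  sum_nonneg fun j _ => mul_nonneg (hu.1 i j) (nn_nonneg _)

theorem inflow_sq_le {d : ℕ} (x : E d) {u : Mat d} (hu : u ∈ MM d) (i : Fin d) :
    (∑ j ∈ univ.filter (· ≠ i), u i j * nn (x j)) ^ 2 ≤ d * ∑ j, nn (x j) ^ 2 := by
  have h : ∑ j ∈ univ.filter (· ≠ i), u i j * nn (x j) ≤ ∑ j, nn (x j) :=
    (sum_le_sum fun j _ => mul_le_of_le_one_left (nn_nonneg _) (le_one_of_mem_MM hu i j)).trans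
      (sum_le_sum_of_subset_of_nonneg (filter_subset _ _) fun j _ _ => nn_nonneg _)
  calc _ ≤ (∑ j, nn (x j)) ^ 2 := pow_le_pow_left₀ (inflow_nonneg x hu i) h 2
    _ ≤ _ := by simpa using sq_sum_le_card_mul_sum_sq (s := univ) (f := fun j => nn (x j))

theorem bf_mul_le {d : ℕ} {ℓ μ γ : Fin d → ℝ} {μo : Fin d → Fin d → ℝ}
    (hμo : ∀ i j, i ≠ j → 0 ≤ μo i j) {x : E d} {u : Mat d} (hu : u ∈ Mx d x) {m : ℝ} {i : Fin d}
    (hm : 0 < m) (hmγ : m ≤ γ i) (hmμ : m ≤ μ i) :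
    bf d ℓ μ γ μo x u i * x i ≤ |ℓ i| * ‖x‖ - m * (nn (x i) ^ 2 + qf d x u i ^ 2) := by
  have hs := hu.2 i
  have hs0 := inflow_nonneg x hu.1 i
  have hl : ℓ i * x i ≤ |ℓ i| * ‖x‖ := by
    refine (le_abs_self _).trans ?_
    rw [abs_mul]
    gcongr
    exact abs_apply_le_norm x i
  have ht : 0 ≤ ∑ j ∈ univ.filter (· ≠ i), μo i j * u i j * nn (x j) :=
    sum_nonneg fun j hj => mul_nonneg (mul_nonneg (hμo i j (by simpa [eq_comm] using hj))
      (hu.1.1 i j)) (nn_nonneg _)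
  have hz : x i ≤ 0 → ∑ j ∈ univ.filter (· ≠ i), μo i j * u i j * nn (x j) = 0 := by
    intro hx
    have h0 : ∑ j ∈ univ.filter (· ≠ i), u i j * nn (x j) = 0 :=
      le_antisymm (hs.trans (max_le hx le_rfl)) hs0
    rw [sum_eq_zero_iff_of_nonneg fun j _ => mul_nonneg (hu.1.1 i j) (nn_nonneg _)] at h0
    exact sum_eq_zero fun j hj => by rw [mul_assoc, h0 j hj, mul_zero]
  unfold bf qf
  generalize ∑ j ∈ univ.filter (· ≠ i), μo i j * u i j * nn (x j) = t at ht hz ⊢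
  generalize ∑ j ∈ univ.filter (· ≠ i), u i j * nn (x j) = s at hs hs0 ⊢
  rcases le_total (x i) 0 with hx | hx
  · have hp : pp (x i) = 0 := max_eq_right hx
    have hn : nn (x i) = -x i := max_eq_left (by linarith)
    rw [hp] at hs
    rw [hp, hn, hz hx, le_antisymm hs hs0]
    nlinarith [mul_le_mul_of_nonneg_right hmμ (sq_nonneg (x i))]
  · have hp : pp (x i) = x i := max_eq_left hx
    have hn : nn (x i) = 0 := max_eq_right (by linarith)
    rw [hp] at hs
    rw [hp, hn]
    have h1 : m * (x i - s) ^ 2 ≤ γ i * ((x i - s) * x i) :=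
      mul_le_mul hmγ (by nlinarith [mul_nonneg (sub_nonneg.2 hs) hs0]) (sq_nonneg _)
        (hm.le.trans hmγ)
    nlinarith [mul_nonneg ht hx]

theorem norm_sq_le_nn_qf {d : ℕ} (x : E d) {u : Mat d} (hu : u ∈ MM d) :
    ‖x‖ ^ 2 ≤ (2 * d ^ 2 + 2) * ∑ i, (nn (x i) ^ 2 + qf d x u i ^ 2) := by
  have h (i : Fin d) : x i ^ 2 ≤ nn (x i) ^ 2 + 2 * qf d x u i ^ 2 +
      2 * (d * ∑ j, nn (x j) ^ 2) := by
    have hs := inflow_sq_le x hu i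
    unfold qf
    generalize ∑ j ∈ univ.filter (· ≠ i), u i j * nn (x j) = s at hs ⊢
    have hx : x i ^ 2 = nn (x i) ^ 2 + pp (x i) ^ 2 := by
      rcases le_total (x i) 0 with hx | hx <;> simp [nn, pp, hx]
    nlinarith [sq_nonneg (pp (x i) - 2 * s)]
  have h2 := sum_le_sum fun i (_ : i ∈ univ) => h i
  simp only [sum_add_distrib, ← mul_sum, sum_const, card_univ, Fintype.card_fin,
    nsmul_eq_mul] at h2 ⊢
  rw [EuclideanSpace.real_norm_sq_eq]
  have hn : 0 ≤ ∑ i, nn (x i) ^ 2 := sum_nonneg fun _ _ => sq_nonneg _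
  have hq : 0 ≤ ∑ i, qf d x u i ^ 2 := sum_nonneg fun _ _ => sq_nonneg _
  nlinarith [mul_nonneg (sq_nonneg (d : ℝ)) hq]

/-- Radial component of the drift is dissipative, uniformly over the controls in `M(x)`. -/
theorem exists_sum_bf_mul_le {d : ℕ} (hd : 1 ≤ d) (ℓ : Fin d → ℝ) {μ γ : Fin d → ℝ}
    {μo : Fin d → Fin d → ℝ} (hμ : ∀ i, 0 < μ i) (hγ : ∀ i, 0 < γ i)
    (hμo : ∀ i j, i ≠ j → 0 ≤ μo i j) :
    ∃ L ≥ (0 : ℝ), ∃ c > (0 : ℝ), ∀ x : E d, ∀ u ∈ Mx d x,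
      ∑ i, bf d ℓ μ γ μo x u i * x i ≤ L * ‖x‖ - c * ‖x‖ ^ 2 := by
  have : Nonempty (Fin d) := ⟨⟨0, hd⟩⟩
  obtain ⟨i₀, hi₀⟩ := Finite.exists_min fun i => min (γ i) (μ i)
  set m := min (γ i₀) (μ i₀)
  have hm : 0 < m := lt_min (hγ _) (hμ _)
  refine ⟨∑ i, |ℓ i|, sum_nonneg fun _ _ => abs_nonneg _, m / (2 * d ^ 2 + 2), by positivity,
    fun x u hu => ?_⟩
  have h := sum_le_sum fun i (_ : i ∈ univ) => bf_mul_le (ℓ := ℓ) hμo hu hm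
    ((hi₀ i).trans (min_le_left _ _)) ((hi₀ i).trans (min_le_right _ _))
  rw [sum_sub_distrib, ← sum_mul, ← mul_sum] at h
  refine h.trans (sub_le_sub_left ?_ _)
  rw [div_mul_eq_mul_div, div_le_iff₀ (by positivity), mul_assoc, mul_comm (∑ i, _)]
  exact mul_le_mul_of_nonneg_left (norm_sq_le_nn_qf x hu.1) hm.le

theorem exists_abs_bf_le {d : ℕ} (ℓ μ γ : Fin d → ℝ) (μo : Fin d → Fin d → ℝ) :
    ∃ B : Fin d → ℝ, ∀ x : E d, ‖x‖ ≤ 1 → ∀ u ∈ Mx d x, ∀ i, |bf d ℓ μ γ μo x u i| ≤ B i := by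
  refine ⟨fun i => |ℓ i| + |μ i| + (∑ j ∈ univ.filter (· ≠ i), |μo i j|) + |γ i|,
    fun x hx u hu i => ?_⟩
  have hn (j : Fin d) : |nn (x j)| ≤ 1 := by
    rw [abs_of_nonneg (nn_nonneg _)]
    exact (nn_le_abs _).trans ((abs_apply_le_norm x j).trans hx)
  have hq : |qf d x u i| ≤ 1 := by
    have h0 := inflow_nonneg x hu.1 i
    rw [qf, abs_of_nonneg (sub_nonneg.2 (hu.2 i))]
    exact (sub_le_self _ h0).trans ((pp_le_abs _).trans ((abs_apply_le_norm x i).trans hx))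
  have ht : |∑ j ∈ univ.filter (· ≠ i), μo i j * u i j * nn (x j)| ≤
      ∑ j ∈ univ.filter (· ≠ i), |μo i j| := by
    refine (abs_sum_le_sum_abs _ _).trans (sum_le_sum fun j _ => ?_)
    rw [mul_assoc, abs_mul, abs_mul]
    refine mul_le_of_le_one_right (abs_nonneg _) (mul_le_one₀ ?_ (abs_nonneg _) (hn j))
    rw [abs_of_nonneg (hu.1.1 i j)]
    exact le_one_of_mem_MM hu.1 i j
  have h1 : |μ i * nn (x i)| ≤ |μ i| := by
    rw [abs_mul]; exact mul_le_of_le_one_right (abs_nonneg _) (hn i)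
  have h2 : |γ i * qf d x u i| ≤ |γ i| := by
    rw [abs_mul]; exact mul_le_of_le_one_right (abs_nonneg _) hq
  unfold bf
  refine (abs_sub _ _).trans (add_le_add ((abs_sub _ _).trans (add_le_add
    ((abs_add_le _ _).trans (add_le_add le_rfl h1)) ht)) h2)

theorem hasFDerivAt_norm_rpow_of_ne_zero {F : Type*} [NormedAddCommGroup F]
    [InnerProductSpace ℝ F] (p : ℝ) {x : F} (hx : x ≠ 0) :
    HasFDerivAt (fun y : F => ‖y‖ ^ p) ((p * ‖x‖ ^ (p - 2)) • innerSL ℝ x) x := by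
  have hx' : 0 < ‖x‖ := norm_pos_iff.2 hx
  have h := ((hasStrictFDerivAt_norm_sq x).hasFDerivAt).rpow_const (p := p / 2)
    (Or.inl (by positivity))
  have e (y : F) (q : ℝ) : (‖y‖ ^ 2) ^ q = ‖y‖ ^ (2 * q) := by
    rw [← Real.rpow_natCast_mul (norm_nonneg y)]; norm_num
  simp only [e] at h
  convert h using 1
  · ext y; congr 1; ring
  · rw [← Nat.cast_smul_eq_nsmul ℝ 2, smul_smul]
    congr 1
    rw [show 2 * (p / 2 - 1) = p - 2 by ring]
    push_cast; ring

theorem fderiv_single_of_eq_norm_rpow {d : ℕ} {k : ℝ} {V : E d → ℝ}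
    (hVk : ∀ x : E d, 1 ≤ ‖x‖ → V x = ‖x‖ ^ k) {x : E d} (hx : 1 < ‖x‖) (i : Fin d) :
    fderiv ℝ V x (EuclideanSpace.single i 1) = k * ‖x‖ ^ (k - 2) * x i := by
  have hx0 : x ≠ 0 := norm_pos_iff.1 (one_pos.trans hx)
  have he : V =ᶠ[nhds x] fun y => ‖y‖ ^ k := by
    filter_upwards [continuous_norm.continuousAt.eventually (lt_mem_nhds hx)] with y hy
    exact hVk y hy.le
  rw [he.fderiv_eq, (hasFDerivAt_norm_rpow_of_ne_zero k hx0).fderiv]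
  simp [EuclideanSpace.inner_single_right]

theorem fderiv_fderiv_single_of_eq_norm_rpow {d : ℕ} {k : ℝ} {V : E d → ℝ}
    (hVk : ∀ x : E d, 1 ≤ ‖x‖ → V x = ‖x‖ ^ k) {x : E d} (hx : 1 < ‖x‖) (i : Fin d) :
    fderiv ℝ (fun y => fderiv ℝ V y (EuclideanSpace.single i 1)) x (EuclideanSpace.single i 1) =
      k * ‖x‖ ^ (k - 2) + k * (k - 2) * ‖x‖ ^ (k - 4) * x i ^ 2 := by
  have hx0 : x ≠ 0 := norm_pos_iff.1 (one_pos.trans hx)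
  have he : (fun y => fderiv ℝ V y (EuclideanSpace.single i 1)) =ᶠ[nhds x]
      fun y => k * ‖y‖ ^ (k - 2) * y i := by
    filter_upwards [continuous_norm.continuousAt.eventually (lt_mem_nhds hx)] with y hy
    exact fderiv_single_of_eq_norm_rpow hVk hy i
  have h := ((hasFDerivAt_norm_rpow_of_ne_zero (k - 2) hx0).const_mul k).mul
    (EuclideanSpace.proj (𝕜 := ℝ) i : E d →L[ℝ] ℝ).hasFDerivAt
  rw [he.fderiv_eq]
  refine (DFunLike.congr_fun (HasFDerivAt.fderiv h) _).trans ?_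
  simp [EuclideanSpace.inner_single_right]
  rw [show k - 2 - 2 = k - 4 by ring]
  ring

theorem second_deriv_norm_rpow_le {d : ℕ} {k : ℝ} (hk : 1 ≤ k) {x : E d} (hx : 1 < ‖x‖)
    (i : Fin d) :
    k * ‖x‖ ^ (k - 2) + k * (k - 2) * ‖x‖ ^ (k - 4) * x i ^ 2 ≤
      (k + k * |k - 2|) * ‖x‖ ^ (k - 1) := by
  have hx0 : 0 < ‖x‖ := one_pos.trans hx
  have h1 : ‖x‖ ^ (k - 2) ≤ ‖x‖ ^ (k - 1) :=
    Real.rpow_le_rpow_of_exponent_le hx.le (by linarith)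
  have h2 : ‖x‖ ^ (k - 4) * x i ^ 2 ≤ ‖x‖ ^ (k - 2) := by
    have : x i ^ 2 ≤ ‖x‖ ^ 2 := sq_le_sq.2 (by simpa using abs_apply_le_norm x i)
    calc _ ≤ ‖x‖ ^ (k - 4) * ‖x‖ ^ 2 := by gcongr
      _ = _ := by rw [← Real.rpow_natCast, ← Real.rpow_add hx0]; norm_num; ring_nf
  have h3 : (k - 2) * (‖x‖ ^ (k - 4) * x i ^ 2) ≤ |k - 2| * ‖x‖ ^ (k - 1) :=
    mul_le_mul (le_abs_self _) (h2.trans h1) (by positivity) (abs_nonneg _)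
  nlinarith

theorem exists_mul_rpow_sub_one_le {k A c : ℝ} (hk : 1 ≤ k) (hA : 0 ≤ A) (hc : 0 < c) :
    ∃ C ≥ (0 : ℝ), ∀ r > 0, A * r ^ (k - 1) ≤ C + c * r ^ k := by
  have hR : 0 ≤ A / c := by positivity
  refine ⟨A * (A / c) ^ (k - 1), by positivity, fun r hr => ?_⟩
  rcases le_total r (A / c) with h | h
  · have : r ^ (k - 1) ≤ (A / c) ^ (k - 1) := Real.rpow_le_rpow hr.le h (by linarith)
    have : 0 ≤ c * r ^ k := by positivity
    nlinarith
  · have h1 : A ≤ c * r := by rwa [div_le_iff₀' hc] at h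
    have h2 : r ^ k = r * r ^ (k - 1) := by
      rw [← Real.rpow_one_add' hr.le (by linarith)]; congr 1; ring
    have : 0 ≤ A * (A / c) ^ (k - 1) := by positivity
    have h4 := mul_le_mul_of_nonneg_right h1 (Real.rpow_nonneg hr.le (k - 1))
    rw [h2]; linarith

theorem exists_abs_le_of_norm_le_one {d : ℕ} {f : Fin d → E d → ℝ} (hf : ∀ i, Continuous (f i)) :
    ∃ B : Fin d → ℝ, ∀ i x, ‖x‖ ≤ 1 → |f i x| ≤ B i := by
  have h (i : Fin d) : ∃ B, ∀ x, ‖x‖ ≤ 1 → |f i x| ≤ B := by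
    obtain ⟨B, hB⟩ := (isCompact_closedBall (0 : E d) 1).exists_bound_of_continuousOn
      (hf i).continuousOn
    exact ⟨B, fun x hx => hB x (by simpa using hx)⟩
  exact ⟨fun i => (h i).choose, fun i => (h i).choose_spec⟩

/-- Uniform stability: for a nonnegative `C²` Lyapunov function `𝒱` equal to `|x|^k`
outside the unit ball, and diffusion coefficients `a_i > 0`, there are `c₅, c₆ > 0`
with `sup_{u ∈ M(x)} L^u 𝒱(x) ≤ c₅ - c₆ |x|^k` for all `x`, where
`L^u 𝒱(x) = (1/2) Σ_i a_i ∂_{ii}𝒱(x) + Σ_i b_i(x,u) ∂_i 𝒱(x)`. -/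
theorem stmt9 (d : ℕ) (hd : 1 ≤ d)
    (ℓ μ γ : Fin d → ℝ) (μo : Fin d → Fin d → ℝ)
    (hμ : ∀ i, 0 < μ i) (hγ : ∀ i, 0 < γ i) (hμo : ∀ i j, i ≠ j → 0 ≤ μo i j)
    (k : ℝ) (hk : 1 ≤ k)
    (V : E d → ℝ) (hV : ContDiff ℝ 2 V) (hV0 : ∀ x, 0 ≤ V x)
    (hVk : ∀ x : E d, 1 ≤ ‖x‖ → V x = ‖x‖ ^ k)
    (a : Fin d → ℝ) (ha : ∀ i, 0 < a i) :
    ∃ c₅ > (0 : ℝ), ∃ c₆ > (0 : ℝ), ∀ x : E d, ∀ u ∈ Mx d x,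
      (1 / 2) * (∑ i, a i *
          fderiv ℝ (fun y => fderiv ℝ V y (EuclideanSpace.single i 1)) x
            (EuclideanSpace.single i 1)) +
        ∑ i, bf d ℓ μ γ μo x u i * fderiv ℝ V x (EuclideanSpace.single i 1) ≤
      c₅ - c₆ * ‖x‖ ^ k := by
  obtain ⟨L, hL, c, hc, hdrift⟩ := exists_sum_bf_mul_le hd ℓ hμ hγ hμo
  obtain ⟨B, hB⟩ := exists_abs_bf_le ℓ μ γ μo
  have hV1 (i : Fin d) : ContDiff ℝ 1 fun y => fderiv ℝ V y (EuclideanSpace.single i 1) :=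
    (hV.fderiv_right (m := 1) (by norm_num)).clm_apply contDiff_const
  obtain ⟨G, hG⟩ := exists_abs_le_of_norm_le_one fun i => (hV1 i).continuous
  obtain ⟨H, hH⟩ := exists_abs_le_of_norm_le_one fun i =>
    ((hV1 i).continuous_fderiv (by norm_num)).clm_apply
      (continuous_const (y := EuclideanSpace.single i (1 : ℝ)))
  have hk0 : 0 < k := by linarith
  have hasum : 0 ≤ ∑ i, a i := sum_nonneg fun i _ => (ha i).le
  set A := 1 / 2 * ((∑ i, a i) * (k + k * |k - 2|)) + k * L with hA
  have hA0 : 0 ≤ A := by positivity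
  obtain ⟨C, hC, hCr⟩ := exists_mul_rpow_sub_one_le hk hA0 (c := k * c / 2) (by positivity)
  set D := 1 / 2 * (∑ i, a i * H i) + ∑ i, B i * G i
  refine ⟨C + |D| + k * c / 2, by positivity, k * c / 2, by positivity, fun x u hu => ?_⟩
  rcases le_or_gt ‖x‖ 1 with hx | hx
  · have h1 : ∑ i, a i * fderiv ℝ (fun y => fderiv ℝ V y (EuclideanSpace.single i 1)) x
        (EuclideanSpace.single i 1) ≤ ∑ i, a i * H i := sum_le_sum fun i _ =>
      mul_le_mul_of_nonneg_left ((le_abs_self _).trans (hH i x hx)) (ha i).le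
    have h2 : ∑ i, bf d ℓ μ γ μo x u i * fderiv ℝ V x (EuclideanSpace.single i 1) ≤
        ∑ i, B i * G i := by
      refine sum_le_sum fun i _ => (le_abs_self _).trans ?_
      rw [abs_mul]
      exact mul_le_mul (hB x hx u hu i) (hG i x hx) (abs_nonneg _)
        ((abs_nonneg _).trans (hB x hx u hu i))
    have h3 : k * c / 2 * ‖x‖ ^ k ≤ k * c / 2 := mul_le_of_le_one_right (by positivity)
      (Real.rpow_le_one (norm_nonneg _) hx hk0.le)
    have h4 : 1 / 2 * (∑ i, a i * H i) + ∑ i, B i * G i ≤ |D| := le_abs_self D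
    linarith
  · have hx0 : 0 < ‖x‖ := one_pos.trans hx
    have h1 : ∑ i, a i * fderiv ℝ (fun y => fderiv ℝ V y (EuclideanSpace.single i 1)) x
        (EuclideanSpace.single i 1) ≤
        (∑ i, a i) * ((k + k * |k - 2|) * ‖x‖ ^ (k - 1)) := by
      rw [sum_mul]
      refine sum_le_sum fun i _ => mul_le_mul_of_nonneg_left ?_ (ha i).le
      rw [fderiv_fderiv_single_of_eq_norm_rpow hVk hx i]
      exact second_deriv_norm_rpow_le hk hx i
    have h2 : ∑ i, bf d ℓ μ γ μo x u i * fderiv ℝ V x (EuclideanSpace.single i 1) ≤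
        k * L * ‖x‖ ^ (k - 1) - k * c * ‖x‖ ^ k := by
      have e1 : ‖x‖ ^ (k - 1) = ‖x‖ ^ (k - 2) * ‖x‖ := by
        rw [← Real.rpow_add_one hx0.ne']; congr 1; ring
      have e2 : ‖x‖ ^ k = ‖x‖ ^ (k - 2) * ‖x‖ ^ 2 := by
        rw [← Real.rpow_natCast ‖x‖ 2, ← Real.rpow_add hx0]; congr 1; push_cast; ring
      calc _ = k * ‖x‖ ^ (k - 2) * ∑ i, bf d ℓ μ γ μo x u i * x i := by
            rw [mul_sum]
            refine sum_congr rfl fun i _ => ?_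
            rw [fderiv_single_of_eq_norm_rpow hVk hx i]; ring
        _ ≤ k * ‖x‖ ^ (k - 2) * (L * ‖x‖ - c * ‖x‖ ^ 2) :=
            mul_le_mul_of_nonneg_left (hdrift x u hu) (by positivity)
        _ = _ := by rw [e1, e2]; ring
    have h3 := hCr ‖x‖ hx0
    have h4 : 0 ≤ |D| + k * c / 2 := by positivity
    rw [hA] at h3
    linarith
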